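/- Suppose p_XY has full support, and let U be a finite set and p_{U|XYZ} a conditional pmf such that the joint pmf p_XYZ·p_{U|XYZ} satisfies the three Markov chains U−X−Y, Z−(U,Y)−X, and U−(Y,Z)−X. Then (the matching condition in the definition of W holds and) I(Z;U|Y) ≥ H(W|Y), where H(W|Y) is evaluated with the pmf p_WY(i,y) := Σ_{x∈X} Σ_{z∈Z_i^(y)} p_XYZ(x,y,z). -/

import Mathlib

open scoped BigOperators
open scoped Classical

namespace SC

/-- `p` is a probability mass function on a finite type. -/
def IsPMF {α : Type*} [Fintype α] (p : α → ℝ) : Prop :=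
  (∀ a, 0 ≤ p a) ∧ ∑ a, p a = 1

/-- Total variation distance between pmfs on a finite type. -/
noncomputable def tv {α : Type*} [Fintype α] (p q : α → ℝ) : ℝ :=
  (1 / 2) * ∑ a, |p a - q a|

/-- Shannon entropy (in bits) of the pushforward of the pmf `p` along `f`. -/
noncomputable def Hof {Ω β : Type*} [Fintype Ω] (p : Ω → ℝ) (f : Ω → β) : ℝ :=
  (∑ b ∈ Finset.univ.image f,
      Real.negMulLog (∑ a ∈ Finset.univ.filter (fun a => f a = b), p a)) / Real.log 2

/-- Conditional Shannon entropy `H(A | B)` (bits) computed from the joint pmf `p`. -/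
noncomputable def condEnt {Ω α β : Type*} [Fintype Ω] (p : Ω → ℝ)
    (A : Ω → α) (B : Ω → β) : ℝ :=
  Hof p (fun ω => (A ω, B ω)) - Hof p B

/-- Conditional mutual information `I(A ; C ∣ B)` (bits) from the joint pmf `p`. -/
noncomputable def cmi {Ω α β γ : Type*} [Fintype Ω] (p : Ω → ℝ)
    (A : Ω → α) (B : Ω → β) (C : Ω → γ) : ℝ :=
  Hof p (fun ω => (A ω, B ω)) + Hof p (fun ω => (B ω, C ω)) - Hof p B
    - Hof p (fun ω => (A ω, B ω, C ω))

/-- The joint pmf `p_XYZ(x,y,z) = p_XY(x,y) · p_{Z|XY}(z|x,y)`. -/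
noncomputable def jointXYZ {𝒳 𝒴 𝒵 : Type*} [Fintype 𝒳] [Fintype 𝒴] [Fintype 𝒵]
    (pXY : 𝒳 × 𝒴 → ℝ) (Q : 𝒳 → 𝒴 → 𝒵 → ℝ) : 𝒳 × 𝒴 × 𝒵 → ℝ :=
  fun w => pXY (w.1, w.2.1) * Q w.1 w.2.1 w.2.2

/-- The `n`-fold product of `p_XYZ`. -/
noncomputable def prodXYZ {𝒳 𝒴 𝒵 : Type*} [Fintype 𝒳] [Fintype 𝒴] [Fintype 𝒵]
    (pXY : 𝒳 × 𝒴 → ℝ) (Q : 𝒳 → 𝒴 → 𝒵 → ℝ) (n : ℕ) :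
    (Fin n → 𝒳) × (Fin n → 𝒴) × (Fin n → 𝒵) → ℝ :=
  fun w => ∏ i, jointXYZ pXY Q (w.1 i, w.2.1 i, w.2.2 i)

/-- The joint pmf of `(U, X, Y, Z)` obtained from `p_XYZ` and a conditional pmf
`p_{U|XYZ}` (with `U` ranging over `Fin k`). -/
noncomputable def jointU {𝒳 𝒴 𝒵 : Type*} [Fintype 𝒳] [Fintype 𝒴] [Fintype 𝒵]
    (pXY : 𝒳 × 𝒴 → ℝ) (Q : 𝒳 → 𝒴 → 𝒵 → ℝ) {k : ℕ}
    (pU : 𝒳 × 𝒴 × 𝒵 → Fin k → ℝ) : Fin k × 𝒳 × 𝒴 × 𝒵 → ℝ :=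
  fun w => jointXYZ pXY Q w.2 * pU w.2 w.1

/-- `p_{U|XYZ}` is a conditional pmf whose joint pmf `p_XYZ · p_{U|XYZ}` satisfies the
three Markov chains `U−X−Y`, `Z−(U,Y)−X` and `U−(Y,Z)−X`. -/
def SecureAux {𝒳 𝒴 𝒵 : Type*} [Fintype 𝒳] [Fintype 𝒴] [Fintype 𝒵]
    (pXY : 𝒳 × 𝒴 → ℝ) (Q : 𝒳 → 𝒴 → 𝒵 → ℝ) {k : ℕ}
    (pU : 𝒳 × 𝒴 × 𝒵 → Fin k → ℝ) : Prop :=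
  (∀ w, IsPMF (pU w)) ∧
  cmi (jointU pXY Q pU) (fun w => w.1) (fun w => w.2.1) (fun w => w.2.2.1) = 0 ∧
  cmi (jointU pXY Q pU) (fun w => w.2.2.2) (fun w => (w.1, w.2.2.1)) (fun w => w.2.1) = 0 ∧
  cmi (jointU pXY Q pU) (fun w => w.1) (fun w => (w.2.2.1, w.2.2.2)) (fun w => w.2.1) = 0

/-- `(p_XY, p_{Z|XY})` is computable with perfect security. -/
def PerfectlySecure {𝒳 𝒴 𝒵 : Type*} [Fintype 𝒳] [Fintype 𝒴] [Fintype 𝒵]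
    (pXY : 𝒳 × 𝒴 → ℝ) (Q : 𝒳 → 𝒴 → 𝒵 → ℝ) : Prop :=
  ∃ (k : ℕ) (pU : 𝒳 × 𝒴 × 𝒵 → Fin k → ℝ), SecureAux pXY Q pU

/-- `Z^(y)`: outputs occurring with positive probability when Bob's input is `y`. -/
def Zyset {𝒳 𝒴 𝒵 : Type*} (Q : 𝒳 → 𝒴 → 𝒵 → ℝ) (y : 𝒴) : Set 𝒵 :=
  {z | ∃ x, 0 < Q x y z}

/-- `z ∼_y z'`: the columns of `z` and `z'` are positive scalar multiples of each
other (both in `Z^(y)`). -/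
def SimRel {𝒳 𝒴 𝒵 : Type*} (Q : 𝒳 → 𝒴 → 𝒵 → ℝ) (y : 𝒴) (z z' : 𝒵) : Prop :=
  z ∈ Zyset Q y ∧ z' ∈ Zyset Q y ∧ ∃ c : ℝ, 0 < c ∧ ∀ x, Q x y z = c * Q x y z'

/-- The `≡_y`-equivalence class of `z₀`, where `≡_y` is the equivalence relation
generated by `∼_y`. -/
def classOf {𝒳 𝒴 𝒵 : Type*} (Q : 𝒳 → 𝒴 → 𝒵 → ℝ) (y : 𝒴) (z₀ : 𝒵) : Set 𝒵 :=
  {z | Relation.EqvGen (SimRel Q y) z z₀}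

/-- The probability column vector `α` of (the class of) `z`: the normalized column. -/
noncomputable def alphaVec {𝒳 𝒴 𝒵 : Type*} [Fintype 𝒳]
    (Q : 𝒳 → 𝒴 → 𝒵 → ℝ) (y : 𝒴) (z : 𝒵) : 𝒳 → ℝ :=
  fun x => Q x y z / ∑ x', Q x' y z

/-- The set `{α_1^(y), …, α_{k(y)}^(y)}` of probability vectors of the classes at `y`. -/
def alphaSet {𝒳 𝒴 𝒵 : Type*} [Fintype 𝒳] (Q : 𝒳 → 𝒴 → 𝒵 → ℝ) (y : 𝒴) :
    Set (𝒳 → ℝ) :=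
  alphaVec Q y '' Zyset Q y

/-- `Σ_{z ∈ Z_i^(y)} p_{Z|XY}(z|x,y)` where `Z_i^(y)` is the class of `z₀`. -/
noncomputable def classSumOf {𝒳 𝒴 𝒵 : Type*} [Fintype 𝒵]
    (Q : 𝒳 → 𝒴 → 𝒵 → ℝ) (x : 𝒳) (y : 𝒴) (z₀ : 𝒵) : ℝ :=
  ∑ z ∈ Finset.univ.filter (fun z => z ∈ classOf Q y z₀), Q x y z

/-- `Σ_{z ∈ Z_i^(y)} p_{Z|XY}(z|x,y)` where `Z_i^(y)` is the class with vector `α`. -/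
noncomputable def classSumA {𝒳 𝒴 𝒵 : Type*} [Fintype 𝒳] [Fintype 𝒵]
    (Q : 𝒳 → 𝒴 → 𝒵 → ℝ) (x : 𝒳) (y : 𝒴) (α : 𝒳 → ℝ) : ℝ :=
  ∑ z ∈ Finset.univ.filter (fun z => z ∈ Zyset Q y ∧ alphaVec Q y z = α), Q x y z

/-- The pushforward of the weight function `p` along `f`, evaluated at `b`. -/
noncomputable def marg {Ω β : Type*} [Fintype Ω] (p : Ω → ℝ) (f : Ω → β) (b : β) : ℝ :=
  ∑ a ∈ Finset.univ.filter (fun a => f a = b), p a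

section Marginals

variable {Ω α β γ : Type*} [Fintype Ω] {p : Ω → ℝ}

lemma marg_nonneg (hp : ∀ ω, 0 ≤ p ω) (f : Ω → β) (b : β) : 0 ≤ marg p f b :=
  Finset.sum_nonneg fun a _ => hp a

lemma marg_pos_iff (hp : ∀ ω, 0 ≤ p ω) {f : Ω → β} {b : β} :
    0 < marg p f b ↔ ∃ ω, f ω = b ∧ 0 < p ω := by
  rw [marg, Finset.sum_pos_iff_of_nonneg fun a _ => hp a]
  simp

lemma marg_congr {f : Ω → β} {g : Ω → γ} {b : β} {c : γ}
    (h : ∀ ω, p ω ≠ 0 → (f ω = b ↔ g ω = c)) : marg p f b = marg p g c := by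
  unfold marg
  rw [Finset.sum_filter, Finset.sum_filter]
  refine Finset.sum_congr rfl fun ω _ => ?_
  by_cases h0 : p ω = 0
  · simp [h0]
  · simp [h ω h0]

lemma sum_marg_prodMk [Fintype γ] (f : Ω → β) (g : Ω → γ) (b : β) :
    ∑ c, marg p (fun ω => (f ω, g ω)) (b, c) = marg p f b := by
  simp only [marg, Finset.sum_filter, Prod.mk.injEq, ite_and]
  rw [Finset.sum_comm]
  refine Finset.sum_congr rfl fun ω _ => ?_
  by_cases h : f ω = b <;> simp [h]

lemma sum_mul_comp_eq_sum_marg [Fintype β] (f : Ω → β) (F : β → ℝ) :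
    ∑ ω, p ω * F (f ω) = ∑ b, marg p f b * F b := by
  simp only [marg, Finset.sum_mul, Finset.sum_filter]
  rw [Finset.sum_comm]
  simp

lemma Hof_eq_sum_log (f : Ω → β) :
    Hof p f = (∑ ω, p ω * -Real.log (marg p f (f ω))) / Real.log 2 := by
  unfold Hof
  congr 1
  rw [← Finset.sum_fiberwise_of_maps_to
    (t := Finset.univ.image f) (g := f) (fun ω _ => Finset.mem_image_of_mem f (Finset.mem_univ ω))]
  refine Finset.sum_congr rfl fun b _ => ?_
  rw [Real.negMulLog, neg_mul, ← mul_neg, Finset.sum_mul]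
  refine Finset.sum_congr rfl fun ω hω => ?_
  rw [(Finset.mem_filter.mp hω).2, marg]

/-- Entropy depends only on the partition of the support induced by the random variable. -/
lemma Hof_congr {f : Ω → β} {g : Ω → γ}
    (h : ∀ ω ω', p ω ≠ 0 → p ω' ≠ 0 → (f ω = f ω' ↔ g ω = g ω')) : Hof p f = Hof p g := by
  rw [Hof_eq_sum_log, Hof_eq_sum_log]
  congr 1
  refine Finset.sum_congr rfl fun ω _ => ?_
  by_cases h0 : p ω = 0
  · simp [h0]
  · rw [marg_congr fun ω' h' => h ω' ω h' h0]

lemma Hof_comp {Ω' : Type*} [Fintype Ω'] (g : Ω → Ω') (f : Ω' → β) :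
    Hof (marg p g) f = Hof p (fun ω => f (g ω)) := by
  have hm (b : β) : marg (marg p g) f b = marg p (fun ω => f (g ω)) b := by
    have := sum_mul_comp_eq_sum_marg (p := p) g fun a => if f a = b then 1 else 0
    simpa [marg, Finset.sum_filter] using this.symm
  rw [Hof_eq_sum_log, Hof_eq_sum_log,
    sum_mul_comp_eq_sum_marg g fun a => -Real.log (marg p (fun ω => f (g ω)) (f a))]
  simp only [hm]

end Marginals

section ConditionalMutualInformation

/-- The pointwise contribution to a conditional mutual information, in terms of the probabilities
`P`, `r`, `s`, `m` of `(a, b, c)`, `(a, b)`, `(b, c)`, `b`, corrected so that it is nonnegative. -/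
noncomputable def cmiTerm (P r s m : ℝ) : ℝ :=
  P * (Real.log P - Real.log r - Real.log s + Real.log m) - P + r * s / m

lemma cmiTerm_nonneg_and_eq_of_eq_zero {P r s m : ℝ} (hP : 0 ≤ P) (hPr : P ≤ r) (hPs : P ≤ s)
    (hrm : r ≤ m) : 0 ≤ cmiTerm P r s m ∧ (cmiTerm P r s m = 0 → P * m = r * s) := by
  unfold cmiTerm
  rcases (hP.trans hPr).eq_or_lt with hr | hr
  · obtain rfl : P = 0 := by linarith
    simp [← hr]
  rcases (hP.trans hPs).eq_or_lt with hs | hs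
  · obtain rfl : P = 0 := by linarith
    simp [← hs]
  have hm : 0 < m := hr.trans_le hrm
  have hR : 0 < r * s / m := by positivity
  have key : P * (Real.log P - Real.log r - Real.log s + Real.log m) - P + r * s / m
      = r * s / m * InformationTheory.klFun (P / (r * s / m)) := by
    rcases hP.eq_or_lt with rfl | hP
    · simp [InformationTheory.klFun]
    · rw [InformationTheory.klFun, Real.log_div hP.ne' hR.ne', Real.log_div (by positivity) hm.ne',
        Real.log_mul hr.ne' hs.ne']
      field_simp
      ring
  rw [key]
  refine ⟨mul_nonneg hR.le (InformationTheory.klFun_nonneg (by positivity)), fun h => ?_⟩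
  have h1 := (InformationTheory.klFun_eq_zero_iff (by positivity)).mp
    ((mul_eq_zero.mp h).resolve_left hR.ne')
  rw [div_eq_one_iff_eq hR.ne'] at h1
  rw [h1]
  field_simp

variable {Ω α β γ : Type*} [Fintype Ω] {p : Ω → ℝ}

lemma marg_le_marg (hp : ∀ ω, 0 ≤ p ω) {f : Ω → β} {g : Ω → γ} {b : β} {c : γ}
    (h : ∀ ω, f ω = b → g ω = c) : marg p f b ≤ marg p g c :=
  Finset.sum_le_sum_of_subset_of_nonneg
    (fun ω hω => by simpa using h ω (by simpa using hω)) fun ω _ _ => hp ω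

variable (A : Ω → α) (B : Ω → β) (C : Ω → γ)

lemma cmiTerm_marg (hp : ∀ ω, 0 ≤ p ω) (t : α × β × γ) :
    0 ≤ cmiTerm (marg p (fun ω => (A ω, B ω, C ω)) t)
        (marg p (fun ω => (A ω, B ω)) (t.1, t.2.1)) (marg p (fun ω => (B ω, C ω)) t.2)
        (marg p B t.2.1) ∧
      (cmiTerm (marg p (fun ω => (A ω, B ω, C ω)) t)
          (marg p (fun ω => (A ω, B ω)) (t.1, t.2.1)) (marg p (fun ω => (B ω, C ω)) t.2)
          (marg p B t.2.1) = 0 →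
        marg p (fun ω => (A ω, B ω, C ω)) t * marg p B t.2.1
          = marg p (fun ω => (A ω, B ω)) (t.1, t.2.1) * marg p (fun ω => (B ω, C ω)) t.2) :=
  cmiTerm_nonneg_and_eq_of_eq_zero (marg_nonneg hp _ _)
    (marg_le_marg hp (by rintro ω rfl; rfl)) (marg_le_marg hp (by rintro ω rfl; rfl))
    (marg_le_marg hp fun ω h => congrArg Prod.snd h)

variable [Fintype α] [Fintype β] [Fintype γ]

lemma cmi_eq_sum_cmiTerm :
    cmi p A B C = (∑ t : α × β × γ,
      cmiTerm (marg p (fun ω => (A ω, B ω, C ω)) t) (marg p (fun ω => (A ω, B ω)) (t.1, t.2.1))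
        (marg p (fun ω => (B ω, C ω)) t.2) (marg p B t.2.1)) / Real.log 2 := by
  have hAB (b : β) : ∑ a, marg p (fun ω => (A ω, B ω)) (a, b) = marg p B b := by
    rw [← sum_marg_prodMk B A b]
    exact Finset.sum_congr rfl fun a _ => marg_congr fun ω _ => by simp [and_comm]
  have hR : ∑ t : α × β × γ, marg p (fun ω => (A ω, B ω)) (t.1, t.2.1)
      * marg p (fun ω => (B ω, C ω)) t.2 / marg p B t.2.1 = ∑ ω, p ω := by
    simp only [Fintype.sum_prod_type]
    rw [Finset.sum_comm]
    have (b : β) : ∑ a, ∑ c, marg p (fun ω => (A ω, B ω)) (a, b)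
        * marg p (fun ω => (B ω, C ω)) (b, c) / marg p B b = marg p B b := by
      simp only [← Finset.sum_div, ← Finset.mul_sum, sum_marg_prodMk, ← Finset.sum_mul, hAB]
      exact mul_self_div_self _
    simp only [this]
    simpa using (sum_mul_comp_eq_sum_marg (p := p) B fun _ => 1).symm
  have hP : ∑ t, marg p (fun ω => (A ω, B ω, C ω)) t = ∑ ω, p ω := by
    simpa using (sum_mul_comp_eq_sum_marg (p := p) (fun ω => (A ω, B ω, C ω)) fun _ => 1).symm
  simp only [cmiTerm]
  rw [Finset.sum_add_distrib, Finset.sum_sub_distrib, hR, hP, sub_add_cancel,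
    ← sum_mul_comp_eq_sum_marg (fun ω => (A ω, B ω, C ω)) fun t =>
      Real.log (marg p (fun ω => (A ω, B ω, C ω)) t)
        - Real.log (marg p (fun ω => (A ω, B ω)) (t.1, t.2.1))
        - Real.log (marg p (fun ω => (B ω, C ω)) t.2) + Real.log (marg p B t.2.1), cmi]
  simp only [Hof_eq_sum_log, ← add_div, ← sub_div, ← Finset.sum_add_distrib,
    ← Finset.sum_sub_distrib]
  congr 1
  exact Finset.sum_congr rfl fun ω _ => by ring

lemma cmi_nonneg (hp : ∀ ω, 0 ≤ p ω) : 0 ≤ cmi p A B C := by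
  rw [cmi_eq_sum_cmiTerm A B C]
  exact div_nonneg (Finset.sum_nonneg fun t _ => (cmiTerm_marg A B C hp t).1)
    (Real.log_nonneg one_le_two)

/-- Vanishing conditional mutual information gives the Markov factorization. -/
lemma marg_mul_marg_of_cmi_eq_zero (hp : ∀ ω, 0 ≤ p ω) (h : cmi p A B C = 0)
    (a : α) (b : β) (c : γ) :
    marg p (fun ω => (A ω, B ω, C ω)) (a, b, c) * marg p B b
      = marg p (fun ω => (A ω, B ω)) (a, b) * marg p (fun ω => (B ω, C ω)) (b, c) := by
  rw [cmi_eq_sum_cmiTerm A B C, div_eq_zero_iff, or_iff_left (Real.log_pos one_lt_two).ne',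
    Finset.sum_eq_zero_iff_of_nonneg fun t _ => (cmiTerm_marg A B C hp t).1] at h
  exact (cmiTerm_marg A B C hp (a, b, c)).2 (h (a, b, c) (Finset.mem_univ _))

end ConditionalMutualInformation

/-- If `V` is a function of `(A, B)` and also of `(B, C)` on the support of `p`, then
`H(V | B) ≤ I(A ; C | B)`. -/
lemma condEnt_le_cmi {Ω α β γ δ : Type*} [Fintype Ω] [Fintype α] [Fintype β] [Fintype γ]
    {p : Ω → ℝ} (hp : ∀ ω, 0 ≤ p ω) (A : Ω → α) (B : Ω → β) (C : Ω → γ) (V : Ω → δ)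
    (hA : ∀ ω ω', p ω ≠ 0 → p ω' ≠ 0 → A ω = A ω' → B ω = B ω' → V ω = V ω')
    (hC : ∀ ω ω', p ω ≠ 0 → p ω' ≠ 0 → B ω = B ω' → C ω = C ω' → V ω = V ω') :
    condEnt p V B ≤ cmi p A B C := by
  have hV (ω ω' : Ω) : Set.rangeFactorization V ω = Set.rangeFactorization V ω' ↔ V ω = V ω' :=
    Subtype.ext_iff
  have h := cmi_nonneg A (fun ω => (Set.rangeFactorization V ω, B ω)) C hp
  have h1 : Hof p (fun ω => (A ω, Set.rangeFactorization V ω, B ω)) = Hof p fun ω => (A ω, B ω) :=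
    Hof_congr fun ω ω' h0 h0' => by
      simp only [Prod.mk.injEq, hV]; exact ⟨fun h => ⟨h.1, h.2.2⟩,
        fun h => ⟨h.1, hA ω ω' h0 h0' h.1 h.2, h.2⟩⟩
  have h2 : Hof p (fun ω => ((Set.rangeFactorization V ω, B ω), C ω))
      = Hof p fun ω => (B ω, C ω) :=
    Hof_congr fun ω ω' h0 h0' => by
      simp only [Prod.mk.injEq, hV]; exact ⟨fun h => ⟨h.1.2, h.2⟩,
        fun h => ⟨⟨hC ω ω' h0 h0' h.1 h.2, h.1⟩, h.2⟩⟩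
  have h3 : Hof p (fun ω => (A ω, (Set.rangeFactorization V ω, B ω), C ω))
      = Hof p fun ω => (A ω, B ω, C ω) :=
    Hof_congr fun ω ω' h0 h0' => by
      simp only [Prod.mk.injEq, hV]; exact ⟨fun h => ⟨h.1, h.2.1.2, h.2.2⟩,
        fun h => ⟨h.1, ⟨hA ω ω' h0 h0' h.1 h.2.1, h.2.1⟩, h.2.2⟩⟩
  have h4 : Hof p (fun ω => (Set.rangeFactorization V ω, B ω)) = Hof p fun ω => (V ω, B ω) :=
    Hof_congr fun ω ω' _ _ => by simp only [Prod.mk.injEq, hV]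
  rw [cmi, h1, h2, h3, h4] at h
  rw [cmi, condEnt]
  linarith

lemma alphaVec_eq_of_eq_mul {𝒳 𝒴 𝒵 : Type*} [Fintype 𝒳] {Q : 𝒳 → 𝒴 → 𝒵 → ℝ} {y : 𝒴} {z : 𝒵}
    {v : 𝒳 → ℝ} {c : ℝ} (hc : c ≠ 0) (h : ∀ x, Q x y z = v x * c) :
    alphaVec Q y z = fun x => v x / ∑ x', v x' := by
  funext x
  simp only [alphaVec, h, ← Finset.sum_mul]
  exact mul_div_mul_right _ _ hc

section JointLaw

variable {𝒳 𝒴 𝒵 : Type*} [Fintype 𝒳] [Fintype 𝒴] [Fintype 𝒵]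
  {pXY : 𝒳 × 𝒴 → ℝ} {Q : 𝒳 → 𝒴 → 𝒵 → ℝ} {k : ℕ} {pU : 𝒳 × 𝒴 × 𝒵 → Fin k → ℝ}

lemma jointU_nonneg (hpXY : IsPMF pXY) (hQ : ∀ x y, IsPMF (Q x y)) (hU : ∀ w, IsPMF (pU w))
    (w : Fin k × 𝒳 × 𝒴 × 𝒵) : 0 ≤ jointU pXY Q pU w :=
  mul_nonneg (mul_nonneg (hpXY.1 _) ((hQ _ _).1 _)) ((hU _).1 _)

lemma marg_jointU_snd (hU : ∀ w, IsPMF (pU w)) :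
    marg (jointU pXY Q pU) (fun w => w.2) = jointXYZ pXY Q := by
  funext t
  simp only [marg, Finset.sum_filter, Fintype.sum_prod_type (α₁ := Fin k), Finset.sum_ite_eq',
    Finset.mem_univ, if_true, jointU]
  rw [← Finset.mul_sum, (hU t).2, mul_one]

lemma marg_jointU_fst_snd (hQ : ∀ x y, IsPMF (Q x y)) (hU : ∀ w, IsPMF (pU w)) (x : 𝒳) (y : 𝒴) :
    marg (jointU pXY Q pU) (fun w => (w.2.1, w.2.2.1)) (x, y) = pXY (x, y) := by
  rw [← sum_marg_prodMk _ fun w : Fin k × 𝒳 × 𝒴 × 𝒵 => w.2.2.2]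
  have (z : 𝒵) : marg (jointU pXY Q pU) (fun w => ((w.2.1, w.2.2.1), w.2.2.2)) ((x, y), z)
      = pXY (x, y) * Q x y z := by
    rw [marg_congr (g := fun w => w.2) (c := (x, y, z)) fun w _ => by
      simp only [Prod.ext_iff, and_assoc], marg_jointU_snd hU, jointXYZ]
  simp only [this]
  rw [← Finset.mul_sum, (hQ x y).2, mul_one]

/-- Given that `(U, Y, Z)` has positive probability at `(u, y, z)`, the column of `z` at `y` is
proportional to the likelihood vector of `u`. -/
lemma alphaVec_eq_of_marg_pos (hpXY : IsPMF pXY) (hQ : ∀ x y, IsPMF (Q x y))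
    (hfs : ∀ x y, 0 < pXY (x, y)) (hU : SecureAux pXY Q pU) {w : Fin k × 𝒳 × 𝒴 × 𝒵}
    (hw : 0 < jointU pXY Q pU w) :
    alphaVec Q w.2.2.1 w.2.2.2 = fun x =>
      marg (jointU pXY Q pU) (fun w => (w.1, w.2.1)) (w.1, x)
          / marg (jointU pXY Q pU) (fun w => w.2.1) x /
        ∑ x', marg (jointU pXY Q pU) (fun w => (w.1, w.2.1)) (w.1, x')
          / marg (jointU pXY Q pU) (fun w => w.2.1) x' := by
  obtain ⟨hU0, h1, h2, h3⟩ := hU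
  have hJ := jointU_nonneg hpXY hQ hU0
  obtain ⟨u, x₀, y, z⟩ := w
  dsimp only
  have hmyz : 0 < marg (jointU pXY Q pU) (fun w => (w.2.2.1, w.2.2.2)) (y, z) :=
    (marg_pos_iff hJ).2 ⟨_, rfl, hw⟩
  have hmuy : 0 < marg (jointU pXY Q pU) (fun w => (w.1, w.2.2.1)) (u, y) :=
    (marg_pos_iff hJ).2 ⟨_, rfl, hw⟩
  have hmuyz : 0 < marg (jointU pXY Q pU) (fun w => (w.1, w.2.2.1, w.2.2.2)) (u, y, z) :=
    (marg_pos_iff hJ).2 ⟨_, rfl, hw⟩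
  refine alphaVec_eq_of_eq_mul (div_pos hmyz hmuy).ne' fun x => ?_
  have e1 := marg_mul_marg_of_cmi_eq_zero _ _ _ hJ h1 u x y
  have e2 := marg_mul_marg_of_cmi_eq_zero _ _ _ hJ h2 z (u, y) x
  have e3 := marg_mul_marg_of_cmi_eq_zero _ _ _ hJ h3 u (y, z) x
  rw [marg_jointU_fst_snd hQ hU0] at e1
  rw [marg_congr (g := fun w => w) (c := (u, x, y, z)) fun w _ => by
      simp only [Prod.ext_iff]; tauto,
    marg_congr (f := fun w : Fin k × 𝒳 × 𝒴 × 𝒵 => (w.2.2.2, w.1, w.2.2.1))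
      (g := fun w => (w.1, w.2.2.1, w.2.2.2)) (c := (u, y, z)) fun w _ => by
      simp only [Prod.ext_iff]; tauto,
    marg_congr (f := fun w : Fin k × 𝒳 × 𝒴 × 𝒵 => ((w.1, w.2.2.1), w.2.1))
      (g := fun w => (w.1, w.2.1, w.2.2.1)) (c := (u, x, y)) fun w _ => by
      simp only [Prod.ext_iff]; tauto] at e2
  rw [marg_congr (g := fun w => w) (c := (u, x, y, z)) fun w _ => by
      simp only [Prod.ext_iff]; tauto,
    marg_congr (f := fun w : Fin k × 𝒳 × 𝒴 × 𝒵 => ((w.2.2.1, w.2.2.2), w.2.1))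
      (g := fun w => w.2) (c := (x, y, z)) fun w _ => by
      simp only [Prod.ext_iff]; tauto, marg_jointU_snd hU0] at e3
  have hmx : 0 < marg (jointU pXY Q pU) (fun w => w.2.1) x := by
    refine (hfs x y).trans_le ?_
    rw [← marg_jointU_fst_snd (pXY := pXY) hQ hU0 x y]
    exact marg_le_marg hJ fun w h => congrArg Prod.fst h
  have hxy := hfs x y
  simp only [jointXYZ] at e3
  rw [div_mul_div_comm, eq_div_iff (by positivity)]
  refine mul_left_cancel₀ (mul_pos hxy hmuyz).ne' ?_
  linear_combination
    -marg (jointU pXY Q pU) (fun w => w.2.1) x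
        * marg (jointU pXY Q pU) (fun w => (w.1, w.2.2.1)) (u, y) * e3
      + marg (jointU pXY Q pU) (fun w => w.2.1) x
        * marg (jointU pXY Q pU) (fun w => (w.2.2.1, w.2.2.2)) (y, z) * e2
      + marg (jointU pXY Q pU) (fun w => (w.1, w.2.2.1, w.2.2.2)) (u, y, z)
        * marg (jointU pXY Q pU) (fun w => (w.2.2.1, w.2.2.2)) (y, z) * e1

lemma Q_pos_of_jointU_pos (hQ : ∀ x y, IsPMF (Q x y))
    {w : Fin k × 𝒳 × 𝒴 × 𝒵} (hw : 0 < jointU pXY Q pU w) :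
    0 < Q w.2.1 w.2.2.1 w.2.2.2 := by
  refine ((hQ _ _).1 _).lt_of_ne fun h => hw.ne' ?_
  simp [jointU, jointXYZ, ← h]

lemma alphaSet_subset (hpXY : IsPMF pXY) (hQ : ∀ x y, IsPMF (Q x y))
    (hfs : ∀ x y, 0 < pXY (x, y)) (hU : SecureAux pXY Q pU) (y y' : 𝒴) :
    alphaSet Q y ⊆ alphaSet Q y' := by
  rintro _ ⟨z, ⟨x, hx⟩, rfl⟩
  have hJ := jointU_nonneg hpXY hQ hU.1
  have hpos : 0 < marg (jointU pXY Q pU) (fun w => w.2) (x, y, z) := by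
    rw [marg_jointU_snd hU.1]
    exact mul_pos (hfs x y) hx
  obtain ⟨⟨u, _⟩, rfl, hw⟩ := (marg_pos_iff hJ).1 hpos
  have hux : 0 < marg (jointU pXY Q pU) (fun w => (w.1, w.2.1)) (u, x) :=
    (marg_pos_iff hJ).2 ⟨_, rfl, hw⟩
  have e1 := marg_mul_marg_of_cmi_eq_zero _ _ _ hJ hU.2.1 u x y'
  rw [marg_jointU_fst_snd hQ hU.1] at e1
  have huxy : 0 < marg (jointU pXY Q pU) (fun w => (w.1, w.2.1, w.2.2.1)) (u, x, y') :=
    pos_of_mul_pos_left (e1 ▸ mul_pos hux (hfs x y')) (marg_nonneg hJ _ _)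
  obtain ⟨⟨u', x', y'', z'⟩, h, hw'⟩ := (marg_pos_iff hJ).1 huxy
  obtain ⟨rfl, rfl, rfl⟩ : u' = u ∧ x' = x ∧ y'' = y' := by simpa using h
  refine ⟨z', ⟨_, Q_pos_of_jointU_pos hQ hw'⟩, ?_⟩
  exact (alphaVec_eq_of_marg_pos hpXY hQ hfs hU hw').trans
    (alphaVec_eq_of_marg_pos hpXY hQ hfs hU hw).symm

end JointLaw

variable {𝒳 𝒴 𝒵 : Type*} [Fintype 𝒳] [Fintype 𝒴] [Fintype 𝒵]
variable [Nonempty 𝒳] [Nonempty 𝒴] [Nonempty 𝒵]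

/-- Suppose `p_XY` has full support and the joint pmf
`p_XYZ · p_{U|XYZ}` satisfies the three Markov chains `U−X−Y`, `Z−(U,Y)−X`,
`U−(Y,Z)−X`. Then the matching condition holds and `I(Z;U|Y) ≥ H(W|Y)`, where `W` is
the class-index random variable `W = α(Y,Z)` with
`p_WY(i,y) = Σ_x Σ_{z∈Z_i^(y)} p_XYZ(x,y,z)`. -/
theorem secure_rate_lower_bound_full_support
    (pXY : 𝒳 × 𝒴 → ℝ) (Q : 𝒳 → 𝒴 → 𝒵 → ℝ)
    (hpXY : IsPMF pXY) (hQ : ∀ x y, IsPMF (Q x y))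
    (hfs : ∀ x y, 0 < pXY (x, y))
    (k : ℕ) (pU : 𝒳 × 𝒴 × 𝒵 → Fin k → ℝ) (hU : SecureAux pXY Q pU) :
    (∀ y y' : 𝒴, alphaSet Q y = alphaSet Q y') ∧
    condEnt (jointXYZ pXY Q) (fun w => alphaVec Q w.2.1 w.2.2) (fun w => w.2.1)
      ≤ cmi (jointU pXY Q pU) (fun w => w.2.2.2) (fun w => w.2.2.1)
          (fun w => w.1) := by
  have hJ := jointU_nonneg hpXY hQ hU.1
  refine ⟨fun y y' => (alphaSet_subset hpXY hQ hfs hU y y').antisymm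
    (alphaSet_subset hpXY hQ hfs hU y' y), ?_⟩
  rw [condEnt, ← marg_jointU_snd (pXY := pXY) (Q := Q) hU.1, Hof_comp, Hof_comp]
  refine condEnt_le_cmi hJ (fun w => w.2.2.2) (fun w => w.2.2.1) (fun w => w.1)
    (fun w => alphaVec Q w.2.2.1 w.2.2.2) (fun w w' _ _ hz hy => ?_) fun w w' h h' _ hu => ?_
  · simp only [hz, hy]
  · simp only [alphaVec_eq_of_marg_pos hpXY hQ hfs hU ((hJ w).lt_of_ne' h),
      alphaVec_eq_of_marg_pos hpXY hQ hfs hU ((hJ w').lt_of_ne' h'), hu]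

end SC
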